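/- arXiv:2504.01975 — 2 statements merged into one kernel-verified Lean document; each statement's English description precedes it below -/
import Mathlib

section
/- Let F(n,k) = [(1)_n⁵ / ((1/2)_n · (1+k)_n⁴)] · [(n+2k+2)/(2(n+k+1)⁴)] · (−1/4)^n and G(n,k) = [(1)_n⁵ / ((1/2)_n · (1+k)_n⁴)] · [(5n² + 6nk + 2k² + 10n + 6k + 5)/(4(2n+1)(n+k+1)⁴)] · (−1/4)^n, where n ranges over the natural numbers and k over real numbers with k > −1. Then for all natural numbers n and all real k > −1, F(n+1,k) − F(n,k) = G(n,k+1) − G(n,k); that is, (F,G) is a WZ pair. -/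
/-- The Pochhammer symbol (rising factorial): `poch a n = a (a+1) ⋯ (a+n-1)`. -/
noncomputable def poch (a : ℝ) (n : ℕ) : ℝ := (ascPochhammer ℝ n).eval a

/-- `F(n,k)` of the WZ pair for the simple `ζ(3,a)` formula. -/
noncomputable def Fwz3 (n : ℕ) (k : ℝ) : ℝ :=
  (poch 1 n) ^ 5 / (poch (1 / 2) n * (poch (1 + k) n) ^ 4) *
    (((n : ℝ) + 2 * k + 2) / (2 * ((n : ℝ) + k + 1) ^ 4)) * (-1 / 4 : ℝ) ^ n

/-- `G(n,k)` of the WZ pair for the simple `ζ(3,a)` formula. -/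
noncomputable def Gwz3 (n : ℕ) (k : ℝ) : ℝ :=
  (poch 1 n) ^ 5 / (poch (1 / 2) n * (poch (1 + k) n) ^ 4) *
    ((5 * (n : ℝ) ^ 2 + 6 * (n : ℝ) * k + 2 * k ^ 2 + 10 * (n : ℝ) + 6 * k + 5) /
      (4 * (2 * (n : ℝ) + 1) * ((n : ℝ) + k + 1) ^ 4)) *
    (-1 / 4 : ℝ) ^ n

theorem poch_succ (a : ℝ) (n : ℕ) : poch a (n + 1) = poch a n * (a + n) :=
  ascPochhammer_succ_eval n a

theorem poch_pos {a : ℝ} (ha : 0 < a) (n : ℕ) : 0 < poch a n :=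
  ascPochhammer_pos n a ha

theorem mul_poch_add_one (a : ℝ) (n : ℕ) : a * poch (a + 1) n = poch a n * (a + n) := by
  rw [← poch_succ]
  simp [poch, ascPochhammer_succ_left, Polynomial.eval_comp]

theorem zeta3_WZ_pair :
    ∀ (n : ℕ) (k : ℝ), k > -1 →
      Fwz3 (n + 1) k - Fwz3 n k = Gwz3 n (k + 1) - Gwz3 n k := by
  intro n k hk
  have hk1 : 0 < 1 + k := by linarith
  have hn : (0 : ℝ) ≤ n := n.cast_nonneg
  have hshift : poch (1 + (k + 1)) n = poch (1 + k) n * (1 + k + n) / (1 + k) := by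
    rw [eq_div_iff hk1.ne', ← mul_poch_add_one, ← add_assoc, mul_comm]
  have hhalf : (1 / 2 + n : ℝ) = (2 * n + 1) / 2 := by ring
  have h₁ : (2 * n + 1 : ℝ) ≠ 0 := by positivity
  have h₂ : (n + k + 1 : ℝ) ≠ 0 := by linarith
  have h₃ : (n + k + 2 : ℝ) ≠ 0 := by linarith
  have hQ := (poch_pos hk1 n).ne'
  have hH := (poch_pos (one_half_pos (α := ℝ)) n).ne'
  unfold Fwz3 Gwz3
  simp only [poch_succ, hshift, hhalf, pow_succ (-1 / 4 : ℝ) n]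
  push_cast
  rw [show (1 + k + n : ℝ) = n + k + 1 by ring, show (n + 1 + k + 1 : ℝ) = n + k + 2 by ring,
    show (n + (k + 1) + 1 : ℝ) = n + k + 2 by ring]
  generalize poch 1 n = P at *
  generalize poch (1 / 2) n = H at *
  generalize poch (1 + k) n = Q at *
  generalize (-1 / 4 : ℝ) ^ n = z
  field_simp
  ring
end

section
/- Σ_{k=0}^∞ 1/(k+1)³ = Σ_{N=0}^∞ (77/64) · Π_{n=0}^{N−1} [−(n+1)⁵(205n² + 660n + 532)] / [32(2n+3)⁵(205n² + 250n + 77)], where the empty product (N = 0) equals 1. -/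
open Filter Topology Nat

/-- The Wilf–Zeilberger function whose sum over `k` at `n = 0` is `ζ(3)`. -/
noncomputable def wzF (n k : ℕ) : ℝ :=
  (-1) ^ n * ((n ! : ℝ) ^ 6 / ((2 * n)! : ℝ)) * ((2 + 3 * n + 2 * k) / 2) * (2 * n + k + 2) ^ 4 *
    (((n + k)! : ℝ) / ((2 * n + k + 2)! : ℝ)) ^ 4

/-- The numerator polynomial of the Wilf–Zeilberger mate of `wzF`. -/
noncomputable def wzPoly (n k : ℝ) : ℝ :=
  (n + 1) ^ 4 * (205 * n ^ 2 + 250 * n + 77) +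
    2 * (127 + 763 * n + 1814 * n ^ 2 + 2134 * n ^ 3 + 1243 * n ^ 4 + 287 * n ^ 5) * k +
    2 * (172 + 824 * n + 1464 * n ^ 2 + 1144 * n ^ 3 + 332 * n ^ 4) * k ^ 2 +
    2 * (124 + 444 * n + 524 * n ^ 2 + 204 * n ^ 3) * k ^ 3 +
    (101 + 240 * n + 141 * n ^ 2) * k ^ 4 + 2 * (11 + 13 * n) * k ^ 5 + 2 * k ^ 6

/-- The Wilf–Zeilberger mate of `wzF`. -/
noncomputable def wzG (n k : ℕ) : ℝ :=
  (-1) ^ n * ((n ! : ℝ) ^ 6 / ((2 * n)! : ℝ)) * (wzPoly n k / (4 * (2 * n + 1))) *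
    (((n + k)! : ℝ) / ((2 * n + k + 2)! : ℝ)) ^ 4

theorem factorial_pow_div_succ (n : ℕ) :
    ((n + 1)! : ℝ) ^ 6 / ((2 * (n + 1))! : ℝ) =
      (n ! : ℝ) ^ 6 / ((2 * n)! : ℝ) * ((n + 1) ^ 6 / ((2 * n + 1) * (2 * n + 2))) := by
  rw [show 2 * (n + 1) = 2 * n + 1 + 1 by ring, factorial_succ (2 * n + 1), factorial_succ (2 * n),
    factorial_succ n]
  push_cast
  field_simp
  ring

theorem factorial_ratio_succ_right (n k : ℕ) :
    ((n + (k + 1))! : ℝ) / ((2 * n + (k + 1) + 2)! : ℝ) =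
      ((n + k)! : ℝ) / ((2 * n + k + 2)! : ℝ) * ((n + k + 1) / (2 * n + k + 3)) := by
  rw [show n + (k + 1) = n + k + 1 by ring, show 2 * n + (k + 1) + 2 = 2 * n + k + 2 + 1 by ring,
    factorial_succ (2 * n + k + 2), factorial_succ (n + k)]
  push_cast
  field_simp
  ring

theorem factorial_ratio_succ_left (n k : ℕ) :
    ((n + 1 + k)! : ℝ) / ((2 * (n + 1) + k + 2)! : ℝ) =
      ((n + k)! : ℝ) / ((2 * n + k + 2)! : ℝ) *
        ((n + k + 1) / ((2 * n + k + 3) * (2 * n + k + 4))) := by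
  rw [show n + 1 + k = n + k + 1 by ring,
    show 2 * (n + 1) + k + 2 = 2 * n + k + 2 + 1 + 1 by ring,
    factorial_succ (2 * n + k + 2 + 1), factorial_succ (2 * n + k + 2), factorial_succ (n + k)]
  push_cast
  field_simp
  ring

theorem wzF_sub_wzF_succ (n k : ℕ) :
    wzF n k - wzF (n + 1) k = wzG n k - wzG n (k + 1) := by
  unfold wzF wzG
  rw [factorial_pow_div_succ, factorial_ratio_succ_left, factorial_ratio_succ_right]
  generalize (n ! : ℝ) ^ 6 / ((2 * n)! : ℝ) = c
  generalize ((n + k)! : ℝ) / ((2 * n + k + 2)! : ℝ) = A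
  rw [pow_succ (-1 : ℝ) n]
  generalize (-1 : ℝ) ^ n = s
  push_cast
  have key : ((2 + 3 * n + 2 * k) / 2) * (2 * n + k + 2 : ℝ) ^ 4 +
      (n + 1) ^ 6 / ((2 * n + 1) * (2 * n + 2)) * ((2 + 3 * (n + 1) + 2 * k) / 2) *
        (2 * (n + 1) + k + 2) ^ 4 * ((n + k + 1) / ((2 * n + k + 3) * (2 * n + k + 4))) ^ 4 =
      wzPoly n k / (4 * (2 * n + 1)) -
        wzPoly n (k + 1) / (4 * (2 * n + 1)) * ((n + k + 1) / (2 * n + k + 3)) ^ 4 := by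
    rw [show (2 * ((n : ℝ) + 1) + k + 2) = 2 * n + k + 4 by ring]
    unfold wzPoly
    field_simp
    ring
  linear_combination s * c * A ^ 4 * key

theorem factorial_ratio_le (n k : ℕ) :
    (n ! : ℝ) * (2 * n + k + 2) * (((n + k)! : ℝ) / ((2 * n + k + 2)! : ℝ)) ≤ 1 / (n + k + 1) := by
  have h : n ! * (n + k + 1)! ≤ (2 * n + k + 1)! := by
    have := le_of_dvd (factorial_pos _) (factorial_mul_factorial_dvd_factorial_add n (n + k + 1))
    rwa [show n + (n + k + 1) = 2 * n + k + 1 by ring] at this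
  rw [factorial_succ (2 * n + k + 1)]
  rw [factorial_succ (n + k)] at h
  have h' : (n ! : ℝ) * ((n + k + 1) * (n + k)!) ≤ (2 * n + k + 1)! := by exact_mod_cast h
  have e : (n ! : ℝ) * (2 * n + k + 2) * (((n + k)! : ℝ) /
      (((2 * n + k + 1 + 1) * (2 * n + k + 1)! : ℕ) : ℝ)) = n ! * (n + k)! / (2 * n + k + 1)! := by
    push_cast
    field_simp
    ring
  rw [e, div_le_div_iff₀ (by positivity) (by positivity)]
  linarith

theorem abs_wzF_le (n k : ℕ) : |wzF n k| ≤ 2 / (n + 1) * (1 / ((k : ℝ) + 1) ^ 2) := by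
  have h1 : (n ! : ℝ) ^ 2 / ((2 * n)! : ℝ) ≤ 1 := by
    have := le_of_dvd (factorial_pos _) (factorial_mul_factorial_dvd_factorial_add n n)
    rw [← two_mul] at this
    rw [div_le_one (by positivity), sq]
    exact_mod_cast this
  have h2 := pow_le_pow_left₀ (by positivity) (factorial_ratio_le n k) 4
  have e : |wzF n k| = (n ! : ℝ) ^ 2 / ((2 * n)! : ℝ) * ((2 + 3 * n + 2 * k) / 2) *
      ((n ! : ℝ) * (2 * n + k + 2) * (((n + k)! : ℝ) / ((2 * n + k + 2)! : ℝ))) ^ 4 := by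
    unfold wzF
    simp only [abs_mul, abs_pow, abs_neg, abs_one, one_pow, one_mul]
    rw [abs_of_nonneg (by positivity), abs_of_nonneg (by positivity), abs_of_nonneg (by positivity),
      abs_of_nonneg (by positivity)]
    ring
  rw [e]
  calc _ ≤ 1 * ((2 + 3 * n + 2 * k) / 2) * (1 / ((n : ℝ) + k + 1)) ^ 4 := by gcongr
    _ ≤ 1 * (2 * ((n : ℝ) + k + 1)) * (1 / ((n : ℝ) + k + 1)) ^ 4 := by
      gcongr
      have : (0 : ℝ) ≤ n := by positivity
      have : (0 : ℝ) ≤ k := by positivity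
      linarith
    _ = 2 / ((n : ℝ) + k + 1) * (1 / ((n : ℝ) + k + 1) ^ 2) := by
      field_simp
    _ ≤ _ := by
      have : (0 : ℝ) ≤ n := by positivity
      have : (0 : ℝ) ≤ k := by positivity
      gcongr <;> linarith

theorem summable_one_div_succ_sq : Summable fun k : ℕ => 1 / ((k : ℝ) + 1) ^ 2 := by
  have := (summable_nat_add_iff 1).2 (Real.summable_one_div_nat_pow.2 one_lt_two)
  exact_mod_cast this

theorem summable_wzF (n : ℕ) : Summable (wzF n) :=
  .of_norm_bounded (summable_one_div_succ_sq.mul_left _) (abs_wzF_le n)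

theorem tendsto_tsum_wzF : Tendsto (fun n => ∑' k, wzF n k) atTop (𝓝 0) := by
  have h : Tendsto (fun n : ℕ => 2 / ((n : ℝ) + 1) * ∑' k : ℕ, 1 / ((k : ℝ) + 1) ^ 2)
      atTop (𝓝 0) := by
    have := (tendsto_one_div_add_atTop_nhds_zero_nat (𝕜 := ℝ)).const_mul 2
    simpa only [mul_one_div, mul_zero, zero_mul] using
      this.mul_const (∑' k : ℕ, 1 / ((k : ℝ) + 1) ^ 2)
  refine squeeze_zero_norm (fun n => ?_) h
  rw [← tsum_mul_left]
  exact tsum_of_norm_bounded (summable_one_div_succ_sq.mul_left _).hasSum (abs_wzF_le n)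

theorem wzPoly_nonneg {n k : ℝ} (hn : 0 ≤ n) (hk : 0 ≤ k) : 0 ≤ wzPoly n k := by
  unfold wzPoly
  positivity

theorem wzPoly_le {n k : ℝ} (hn : 0 ≤ n) (hk : 0 ≤ k) :
    wzPoly n k ≤ wzPoly n 1 * (k + 1) ^ 6 := by
  have hp (i : ℕ) (hi : i ≤ 6) : k ^ i ≤ (k + 1) ^ 6 :=
    (pow_le_pow_left₀ hk (by linarith) i).trans (pow_le_pow_right₀ (by linarith) hi)
  have h0 := hp 0 (by norm_num)
  have h1 := hp 1 (by norm_num)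
  have h2 := hp 2 (by norm_num)
  have h3 := hp 3 (by norm_num)
  have h4 := hp 4 (by norm_num)
  have h5 := hp 5 (by norm_num)
  have h6 := hp 6 (by norm_num)
  rw [pow_zero] at h0
  rw [pow_one] at h1
  unfold wzPoly
  generalize (k + 1) ^ 6 = K at *
  linear_combination (n + 1) ^ 4 * (205 * n ^ 2 + 250 * n + 77) * h0 +
    2 * (127 + 763 * n + 1814 * n ^ 2 + 2134 * n ^ 3 + 1243 * n ^ 4 + 287 * n ^ 5) * h1 +
    2 * (172 + 824 * n + 1464 * n ^ 2 + 1144 * n ^ 3 + 332 * n ^ 4) * h2 +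
    2 * (124 + 444 * n + 524 * n ^ 2 + 204 * n ^ 3) * h3 +
    (101 + 240 * n + 141 * n ^ 2) * h4 + 2 * (11 + 13 * n) * h5 + 2 * h6

theorem tendsto_wzG (n : ℕ) : Tendsto (wzG n) atTop (𝓝 0) := by
  have h := (summable_one_div_succ_sq.tendsto_atTop_zero).const_mul
    ((n ! : ℝ) ^ 6 / ((2 * n)! : ℝ) * (wzPoly n 1 / (4 * (2 * n + 1))))
  rw [mul_zero] at h
  refine squeeze_zero_norm (fun k => ?_) h
  have hP : 0 ≤ wzPoly n k := wzPoly_nonneg (by positivity) (by positivity)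
  have hA : ((n + k)! : ℝ) / ((2 * n + k + 2)! : ℝ) ≤ 1 / ((k : ℝ) + 1) ^ 2 := by
    have h1 := factorial_ratio_le n k
    have h2 : (1 : ℝ) ≤ n ! := by exact_mod_cast factorial_pos n
    have h3 : (0 : ℝ) ≤ n := by positivity
    have h4 : (0 : ℝ) ≤ k := by positivity
    have h5 : 1 * ((k : ℝ) + 1) * (((n + k)! : ℝ) / ((2 * n + k + 2)! : ℝ)) ≤ 1 / (k + 1) := by
      refine le_trans ?_ (h1.trans ?_)
      · gcongr <;> linarith
      · gcongr
        linarith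
    rw [one_mul, mul_comm, ← le_div_iff₀ (by positivity)] at h5
    exact h5.trans_eq (by field_simp)
  have e : ‖wzG n k‖ = (n ! : ℝ) ^ 6 / ((2 * n)! : ℝ) * (wzPoly n k / (4 * (2 * n + 1))) *
      (((n + k)! : ℝ) / ((2 * n + k + 2)! : ℝ)) ^ 4 := by
    unfold wzG
    simp only [Real.norm_eq_abs, abs_mul, abs_pow, abs_neg, abs_one, one_pow, one_mul]
    rw [abs_of_nonneg (by positivity), abs_of_nonneg (by positivity), abs_of_nonneg (by positivity)]
  rw [e]
  calc _ ≤ (n ! : ℝ) ^ 6 / ((2 * n)! : ℝ) * (wzPoly n 1 * (k + 1) ^ 6 / (4 * (2 * n + 1))) *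
      (1 / ((k : ℝ) + 1) ^ 2) ^ 4 := by
        have := wzPoly_le (n := n) (k := k) (by positivity) (by positivity)
        have := wzPoly_nonneg (n := n) (k := 1) (by positivity) (by positivity)
        gcongr
    _ = _ := by field_simp

theorem tsum_wzF_sub (n : ℕ) : ∑' k, wzF n k - ∑' k, wzF (n + 1) k = wzG n 0 := by
  have h := ((summable_wzF n).hasSum.sub (summable_wzF (n + 1)).hasSum).tendsto_sum_nat
  simp only [wzF_sub_wzF_succ, Finset.sum_range_sub'] at h
  have h' := (tendsto_wzG n).const_sub (wzG n 0)
  rw [sub_zero] at h'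
  exact tendsto_nhds_unique h h'

theorem wzF_zero (k : ℕ) : wzF 0 k = 1 / ((k : ℝ) + 1) ^ 3 := by
  unfold wzF
  rw [show 2 * 0 + k + 2 = k + 1 + 1 by ring, factorial_succ (k + 1), factorial_succ k, zero_add]
  push_cast
  simp
  field_simp
  ring

theorem wzG_zero_zero : wzG 0 0 = 77 / 64 := by
  norm_num [wzG, wzPoly, factorial]

theorem wzG_succ_zero (n : ℕ) : wzG (n + 1) 0 = wzG n 0 *
    ((-((n : ℝ) + 1) ^ 5 * (205 * (n : ℝ) ^ 2 + 660 * (n : ℝ) + 532)) /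
      (32 * (2 * (n : ℝ) + 3) ^ 5 * (205 * (n : ℝ) ^ 2 + 250 * (n : ℝ) + 77))) := by
  unfold wzG wzPoly
  rw [factorial_pow_div_succ, factorial_ratio_succ_left]
  generalize (n ! : ℝ) ^ 6 / ((2 * n)! : ℝ) = c
  generalize ((n + 0)! : ℝ) / ((2 * n + 0 + 2)! : ℝ) = A
  rw [pow_succ]
  generalize (-1 : ℝ) ^ n = s
  push_cast
  rw [show (2 * (n : ℝ) + 0 + 4) = 2 * (n + 2) by ring,
    show (2 * ((n : ℝ) + 1) + 1) = 2 * n + 3 by ring]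
  simp only [add_zero, mul_zero, zero_pow, ne_eq, OfNat.ofNat_ne_zero, not_false_eq_true]
  field_simp
  ring

theorem wzG_eq_prod (N : ℕ) : wzG N 0 = (77 / 64 : ℝ) *
    ∏ n ∈ Finset.range N,
      (-((n : ℝ) + 1) ^ 5 * (205 * (n : ℝ) ^ 2 + 660 * (n : ℝ) + 532)) /
        (32 * (2 * (n : ℝ) + 3) ^ 5 * (205 * (n : ℝ) ^ 2 + 250 * (n : ℝ) + 77)) := by
  induction N with
  | zero => simp [wzG_zero_zero]
  | succ N ih => rw [wzG_succ_zero, ih, Finset.prod_range_succ, mul_assoc]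

theorem summable_wzG : Summable fun n => wzG n 0 := by
  refine summable_of_ratio_norm_eventually_le (r := 1 / 2) (by norm_num) (.of_forall fun n => ?_)
  rw [wzG_succ_zero, norm_mul, mul_comm]
  gcongr
  rw [neg_mul, norm_div, norm_neg, Real.norm_of_nonneg (by positivity),
    Real.norm_of_nonneg (by positivity), div_le_div_iff₀ (by positivity) (by positivity)]
  have hn : (0 : ℝ) ≤ n := by positivity
  have h1 : ((n : ℝ) + 1) ^ 5 ≤ (2 * n + 3) ^ 5 := by
    gcongr <;> linarith
  have h2 : 205 * (n : ℝ) ^ 2 + 660 * n + 532 ≤ 16 * (205 * (n : ℝ) ^ 2 + 250 * n + 77) := by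
    nlinarith
  have := mul_le_mul h1 h2 (by positivity) (by positivity)
  linarith

theorem zeta3_partial_products :
    ∑' k : ℕ, 1 / ((k : ℝ) + 1) ^ 3 =
      ∑' N : ℕ, (77 / 64 : ℝ) *
        ∏ n ∈ Finset.range N,
          (-((n : ℝ) + 1) ^ 5 * (205 * (n : ℝ) ^ 2 + 660 * (n : ℝ) + 532)) /
            (32 * (2 * (n : ℝ) + 3) ^ 5 * (205 * (n : ℝ) ^ 2 + 250 * (n : ℝ) + 77)) := by
  simp only [← wzG_eq_prod, ← wzF_zero]
  have h := summable_wzG.hasSum.tendsto_sum_nat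
  simp only [← tsum_wzF_sub, Finset.sum_range_sub'] at h
  have h' := tendsto_tsum_wzF.const_sub (∑' k, wzF 0 k)
  rw [sub_zero] at h'
  simpa only [tsum_wzF_sub] using tendsto_nhds_unique h' h
end
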